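/- Let p ∈ (2,∞] and let f belong to C(M,p,μ). Then Σ_{n>0} ‖(f(X_0) − μ(f)) (E(f(X_n)|X_0) − μ(f))‖_1 ≤ (4pM^2/(p−2)) Σ_{n>0} (2α_1(n))^{(p−2)/p}. -/

import Mathlib

open MeasureTheory ProbabilityTheory Filter Set
open scoped ENNReal NNReal Topology

noncomputable section

/-- The intermittent (Liverani–Saussol–Vaienti) map `T_γ` on `[0,1]`. -/
def Tmap (γ : ℝ) (x : ℝ) : ℝ :=
  if x < 1/2 then x * (1 + 2 ^ γ * x ^ γ) else 2 * x - 1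

/-- `K` is the Perron–Frobenius operator of `T_γ` with respect to `ν`:
`ν(f · g∘T_γ) = ν(K f · g)` for all bounded measurable `f, g`. -/
def IsPFOp (γ : ℝ) (ν : Measure ℝ) (K : (ℝ → ℝ) → ℝ → ℝ) : Prop :=
  ∀ f g : ℝ → ℝ, Measurable f → Measurable g → (∃ C, ∀ x, |f x| ≤ C) →
    (∃ C, ∀ x, |g x| ≤ C) →
    ∫ x, f x * g (Tmap γ x) ∂ν = ∫ x, (K f) x * g x ∂ν

/-- Birkhoff sums `S_n(f) = ∑_{i=1}^n f ∘ T_γ^i`. -/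
def Sn (γ : ℝ) (f : ℝ → ℝ) (n : ℕ) (x : ℝ) : ℝ :=
  ∑ i ∈ Finset.range n, f ((Tmap γ)^[i + 1] x)

/-- The class `H_{α,1}` of `α`-Hölder functions (with constant 1) on `[0,1]`. -/
def Hclass (α : ℝ) : Set (ℝ → ℝ) :=
  {f | ∀ x ∈ Set.Icc (0:ℝ) 1, ∀ y ∈ Set.Icc (0:ℝ) 1, |f x - f y| ≤ |x - y| ^ α}

/-- `f_t = 1_{(-∞, t]}`. -/
def indic (t : ℝ) : ℝ → ℝ := Set.indicator (Set.Iic t) (fun _ => 1)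

/-- Nested operator `K^{(n_1,…,n_k)}(f_1,…,f_k)
= K^{n_1}(f_1 · K^{n_2}(f_2 ⋯ K^{n_k}(f_k)⋯))`, encoded by a list of pairs. -/
def nestedK (K : (ℝ → ℝ) → ℝ → ℝ) : List (ℕ × (ℝ → ℝ)) → ℝ → ℝ
  | [] => fun _ => 1
  | (n, f) :: r => K^[n] (fun x => f x * nestedK K r x)

/-- The list `[(n, f_{t_1}), (n_2, f_{t_2}), …, (n_l, f_{t_l})]`. -/
def tList (n : ℕ) {l : ℕ} (ns : Fin l → ℕ) (ts : Fin (l + 1) → ℝ) :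
    List (ℕ × (ℝ → ℝ)) :=
  (n, indic (ts 0)) :: List.ofFn (fun i : Fin l => (ns i, indic (ts i.succ)))

/-- The coefficient `α_1(n)` for an operator `K` with invariant measure `ν`. -/
def alpha1 (K : (ℝ → ℝ) → ℝ → ℝ) (ν : Measure ℝ) (n : ℕ) : ℝ :=
  ⨆ t : ℝ, ∫ x, |K^[n] (indic t) x - ∫ y, indic t y ∂ν| ∂ν

/-- The dependence coefficient `α_k(n)`. -/
def alphaCoef (K : (ℝ → ℝ) → ℝ → ℝ) (ν : Measure ℝ) (k n : ℕ) : ℝ :=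
  max (alpha1 K ν n)
    (⨆ j : Fin (k - 1), ⨆ ns : {m : Fin (j.1 + 1) → ℕ // ∀ i, 1 ≤ m i},
      ⨆ ts : Fin (j.1 + 2) → ℝ,
        ∫ x, |nestedK K (tList n ns.1 ts) x - ∫ y, nestedK K (tList n ns.1 ts) y ∂ν| ∂ν)

/-- The dependence coefficient `β_1(n)`. -/
def beta1 (K : (ℝ → ℝ) → ℝ → ℝ) (ν : Measure ℝ) (n : ℕ) : ℝ :=
  ∫ x, (⨆ t : ℝ, |K^[n] (indic t) x - ∫ y, indic t y ∂ν|) ∂ν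

/-- The dependence coefficient `β_k(n)`. -/
def betaCoef (K : (ℝ → ℝ) → ℝ → ℝ) (ν : Measure ℝ) (k n : ℕ) : ℝ :=
  max (beta1 K ν n)
    (⨆ j : Fin (k - 1), ⨆ ns : {m : Fin (j.1 + 1) → ℕ // ∀ i, 1 ≤ m i},
      ∫ x, (⨆ ts : Fin (j.1 + 2) → ℝ,
        |nestedK K (tList n ns.1 ts) x - ∫ y, nestedK K (tList n ns.1 ts) y ∂ν|) ∂ν)

/-- The operator associated with a Markov transition kernel: `(Kg)(x) = ∫ g(y) K(x,dy)`. -/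
def Kop (K : Kernel ℝ ℝ) (g : ℝ → ℝ) : ℝ → ℝ := fun x => ∫ y, g y ∂(K x)

/-- The class `Mon(M,p,μ)` of monotonic functions on an open interval, vanishing
elsewhere, with tail condition `μ(|g|>t) ≤ M^p t^{-p}` (for `p < ∞`),
resp. `μ(|g|>M) = 0` (for `p = ∞`). -/
def Mon (M : ℝ) (p : ℝ≥0∞) (μ : Measure ℝ) (g : ℝ → ℝ) : Prop :=
  (∃ I : Set ℝ, IsOpen I ∧ I.OrdConnected ∧ (MonotoneOn g I ∨ AntitoneOn g I) ∧
      ∀ x ∉ I, g x = 0) ∧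
  (if p = ∞ then μ {x | M < |g x|} = 0
   else ∀ t : ℝ, 0 < t →
      μ {x | t < |g x|} ≤ ENNReal.ofReal (M ^ p.toReal * t ^ (-p.toReal)))

/-- The class `C(M,p,μ)`: the closure in `L¹(μ)` of convex-type combinations
`∑ a_i g_i`, `∑ |a_i| ≤ 1`, `g_i ∈ Mon(M,p,μ)`. -/
def ClassC (M : ℝ) (p : ℝ≥0∞) (μ : Measure ℝ) (f : ℝ → ℝ) : Prop :=
  Integrable f μ ∧ ∀ ε : ℝ, 0 < ε → ∃ (n : ℕ) (a : Fin n → ℝ) (g : Fin n → ℝ → ℝ),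
    (∑ i, |a i|) ≤ 1 ∧ (∀ i, Mon M p μ (g i)) ∧
    ∫ x, |f x - ∑ i, a i * g i x| ∂μ < ε

/-- The class `Lip_c` of functions `g` with `|g(x) − g(y)| ≤ c(|x−y|)`. -/
def LipC (c : ℝ → ℝ) : Set (ℝ → ℝ) := {g | ∀ x y : ℝ, |g x - g y| ≤ c |x - y|}

/-- The distance `d_c(P,Q) = sup_{g ∈ Lip_c} |P(g) − Q(g)|`. -/
def dC (c : ℝ → ℝ) (P Q : Measure ℝ) : ℝ :=
  ⨆ g : LipC c, |(∫ x, (g : ℝ → ℝ) x ∂P) - ∫ x, (g : ℝ → ℝ) x ∂Q|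

/-- The deviation `|L(x, J) - μ(J)|` of a kernel from a measure on the set `J`. -/
def kerDev (L : Kernel ℝ ℝ) (μ : Measure ℝ) (J : Set ℝ) (x : ℝ) : ℝ≥0∞ :=
  ‖(L x).real J - μ.real J‖ₑ

section kerDev

variable {L : Kernel ℝ ℝ} {μ : Measure ℝ}

lemma measurable_kerDev {J : Set ℝ} (hJ : MeasurableSet J) : Measurable (kerDev L μ J) := by
  have h : Measurable fun x => (L x).real J := (L.measurable_coe hJ).ennreal_toReal
  exact (h.sub_const _).enorm

lemma kerDev_le_one [IsMarkovKernel L] [IsProbabilityMeasure μ] (J : Set ℝ) (x : ℝ) :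
    kerDev L μ J x ≤ 1 := by
  have h : |(L x).real J - μ.real J| ≤ 1 := abs_sub_le_iff.2
    ⟨by linarith [measureReal_le_one (μ := L x) (s := J), measureReal_nonneg (μ := μ) (s := J)],
      by linarith [measureReal_le_one (μ := μ) (s := J), measureReal_nonneg (μ := L x) (s := J)]⟩
  rw [kerDev, Real.enorm_eq_ofReal_abs]
  exact ENNReal.ofReal_le_one.2 h

lemma kerDev_le_add [IsMarkovKernel L] [IsProbabilityMeasure μ] (J : Set ℝ) (x : ℝ) :
    kerDev L μ J x ≤ L x J + μ J := by
  refine (enorm_sub_le).trans (le_of_eq ?_)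
  simp [Real.enorm_eq_ofReal_abs, abs_of_nonneg measureReal_nonneg]

lemma lintegral_kerDev_le_two_mul [IsMarkovKernel L] [IsProbabilityMeasure μ]
    (hinv : μ.bind L = μ) {J : Set ℝ} (hJ : MeasurableSet J) :
    ∫⁻ x, kerDev L μ J x ∂μ ≤ 2 * μ J := by
  calc ∫⁻ x, kerDev L μ J x ∂μ ≤ ∫⁻ x, (L x J + μ J) ∂μ :=
        lintegral_mono fun x => kerDev_le_add J x
    _ = (μ.bind L) J + μ J := by
        rw [lintegral_add_right _ measurable_const, Measure.bind_apply hJ L.aemeasurable]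
        simp
    _ = 2 * μ J := by rw [hinv, two_mul]

lemma kerDev_diff_le [IsMarkovKernel L] [IsProbabilityMeasure μ] {U V : Set ℝ}
    (hV : MeasurableSet V) (hVU : V ⊆ U) (x : ℝ) :
    kerDev L μ (U \ V) x ≤ kerDev L μ U x + kerDev L μ V x := by
  unfold kerDev
  rw [measureReal_sdiff hVU hV, measureReal_sdiff hVU hV]
  rw [show (L x).real U - (L x).real V - (μ.real U - μ.real V)
    = ((L x).real U - μ.real U) - ((L x).real V - μ.real V) by ring]
  exact enorm_sub_le

lemma lintegral_kerDev_le_of_isLowerSet [IsMarkovKernel L] [IsProbabilityMeasure μ] {A : ℝ≥0∞}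
    (hA : ∀ a, ∫⁻ x, kerDev L μ (Iic a) x ∂μ ≤ A) {U : Set ℝ} (hU : IsLowerSet U) :
    ∫⁻ x, kerDev L μ U x ∂μ ≤ A := by
  rcases U.eq_empty_or_nonempty with rfl | hne
  · simp [kerDev]
  by_cases hb : BddAbove U
  · obtain ⟨u, humono, hulim, huU⟩ := exists_seq_tendsto_sSup hne hb
    by_cases hs : sSup U ∈ U
    · have : U = Iic (sSup U) :=
        Subset.antisymm (fun x hx => le_csSup hb hx) fun x hx => hU hx hs
      rw [this]; exact hA _
    · have hUu : U = ⋃ n, Iic (u n) := by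
        refine Subset.antisymm (fun x hx => ?_) (iUnion_subset fun n x hx => hU hx (huU n))
        have hlt : x < sSup U := lt_of_le_of_ne (le_csSup hb hx) fun h => hs (h ▸ hx)
        obtain ⟨n, hn⟩ := (hulim.eventually (lt_mem_nhds hlt)).exists
        exact mem_iUnion.2 ⟨n, hn.le⟩
      have hmono : Monotone fun n => Iic (u n) := fun i j hij => Iic_subset_Iic.2 (humono hij)
      have hlim : ∀ x, Tendsto (fun n => kerDev L μ (Iic (u n)) x) atTop (𝓝 (kerDev L μ U x)) := by
        intro x
        have h1 : ∀ ν : Measure ℝ, IsProbabilityMeasure ν →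
            Tendsto (fun n => ν.real (Iic (u n))) atTop (𝓝 (ν.real U)) := by
          intro ν _
          rw [hUu]
          exact (ENNReal.tendsto_toReal (measure_ne_top _ _)).comp
            (tendsto_measure_iUnion_atTop hmono)
        exact ((h1 (L x) inferInstance).sub (h1 μ inferInstance)).enorm
      calc ∫⁻ x, kerDev L μ U x ∂μ
          = ∫⁻ x, liminf (fun n => kerDev L μ (Iic (u n)) x) atTop ∂μ :=
            lintegral_congr fun x => (hlim x).liminf_eq.symm
        _ ≤ liminf (fun n => ∫⁻ x, kerDev L μ (Iic (u n)) x ∂μ) atTop :=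
            lintegral_liminf_le fun n => measurable_kerDev measurableSet_Iic
        _ ≤ A := by
            refine (liminf_le_liminf (v := fun _ => A) (Eventually.of_forall fun n => hA _)).trans ?_
            simp
  · have : U = univ := by
      refine eq_univ_of_forall fun x => ?_
      obtain ⟨y, hy, hxy⟩ := not_bddAbove_iff.1 hb x
      exact hU hxy.le hy
    simp [this, kerDev]

lemma lintegral_kerDev_le_of_ordConnected [IsMarkovKernel L] [IsProbabilityMeasure μ] {A : ℝ≥0∞}
    (hA : ∀ a, ∫⁻ x, kerDev L μ (Iic a) x ∂μ ≤ A) {J : Set ℝ} (hJ : J.OrdConnected) :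
    ∫⁻ x, kerDev L μ J x ∂μ ≤ 2 * A := by
  let U : Set ℝ := {x | ∃ y ∈ J, x ≤ y}
  let V : Set ℝ := {x | (∃ y ∈ J, x ≤ y) ∧ ∀ y ∈ J, x < y}
  have hU : IsLowerSet U := fun a b hba ⟨y, hy, hay⟩ => ⟨y, hy, hba.trans hay⟩
  have hV : IsLowerSet V := fun a b hba ⟨⟨y, hy, hay⟩, h⟩ =>
    ⟨⟨y, hy, hba.trans hay⟩, fun z hz => hba.trans_lt (h z hz)⟩
  have hVU : V ⊆ U := fun x hx => hx.1
  have hJUV : J = U \ V := by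
    ext x
    refine ⟨fun hx => ⟨⟨x, hx, le_rfl⟩, fun h => lt_irrefl _ (h.2 x hx)⟩, ?_⟩
    rintro ⟨⟨y, hy, hxy⟩, hn⟩
    by_contra hxJ
    refine hn ⟨⟨y, hy, hxy⟩, fun z hz => ?_⟩
    by_contra! hzx
    exact hxJ (hJ.out hz hy ⟨hzx, hxy⟩)
  calc ∫⁻ x, kerDev L μ J x ∂μ ≤ ∫⁻ x, (kerDev L μ U x + kerDev L μ V x) ∂μ := by
        rw [hJUV]
        exact lintegral_mono fun x => kerDev_diff_le hV.ordConnected.measurableSet hVU x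
    _ = ∫⁻ x, kerDev L μ U x ∂μ + ∫⁻ x, kerDev L μ V x ∂μ :=
        lintegral_add_left (measurable_kerDev hU.ordConnected.measurableSet) _
    _ ≤ 2 * A := by
        rw [two_mul]
        exact add_le_add (lintegral_kerDev_le_of_isLowerSet hA hU)
          (lintegral_kerDev_le_of_isLowerSet hA hV)

end kerDev

lemma lintegral_Ioi_min_rpow_le {M p : ℝ} (hM : 0 < M) (hp : 1 < p) {w : ℝ≥0∞} (hw : w ≠ ∞) :
    ∫⁻ t in Ioi (0 : ℝ), min w (ENNReal.ofReal (M / t) ^ p)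
      ≤ ENNReal.ofReal (M * (p / (p - 1))) * w ^ ((p - 1) / p) := by
  have hp0 : 0 < p := by linarith
  have hp1 : 0 < p - 1 := by linarith
  rcases eq_or_ne w 0 with rfl | hw0
  · simp
  obtain ⟨v, hv, rfl⟩ : ∃ v : ℝ, 0 < v ∧ w = ENNReal.ofReal v :=
    ⟨w.toReal, ENNReal.toReal_pos hw0 hw, (ENNReal.ofReal_toReal hw).symm⟩
  set c := M * v ^ (-1 / p) with hc
  have hc0 : 0 < c := by positivity
  have hv1 : v * v ^ (-1 / p) = v ^ ((p - 1) / p) := by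
    rw [← Real.rpow_one_add' hv.le]
    · congr 1; field_simp; ring
    · have : 1 + -1 / p = (p - 1) / p := by field_simp; ring
      rw [this]; positivity
  have h1 : ∫⁻ t in Ioc 0 c, min (ENNReal.ofReal v) (ENNReal.ofReal (M / t) ^ p)
      ≤ ENNReal.ofReal (M * v ^ ((p - 1) / p)) := by
    calc _ ≤ ∫⁻ t in Ioc 0 c, ENNReal.ofReal v := lintegral_mono fun t => min_le_left _ _
      _ = ENNReal.ofReal (v * c) := by
        rw [setLIntegral_const, Real.volume_Ioc, sub_zero, ENNReal.ofReal_mul hv.le]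
      _ = _ := by rw [hc, ← hv1]; congr 1; ring
  have h2 : ∫⁻ t in Ioi c, min (ENNReal.ofReal v) (ENNReal.ofReal (M / t) ^ p)
      ≤ ENNReal.ofReal (M / (p - 1) * v ^ ((p - 1) / p)) := by
    calc _ ≤ ∫⁻ t in Ioi c, ENNReal.ofReal (M ^ p * t ^ (-p)) := by
          refine setLIntegral_mono' measurableSet_Ioi fun t ht => (min_le_right _ _).trans ?_
          have ht0 : 0 < t := hc0.trans ht
          rw [ENNReal.ofReal_rpow_of_nonneg (by positivity) hp0.le,
            Real.div_rpow hM.le ht0.le, Real.rpow_neg ht0.le, div_eq_mul_inv]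
      _ = ENNReal.ofReal (∫ t in Ioi c, M ^ p * t ^ (-p)) := by
          rw [ofReal_integral_eq_lintegral_ofReal]
          · exact (integrableOn_Ioi_rpow_of_lt (by linarith) hc0).const_mul _
          · filter_upwards [ae_restrict_mem measurableSet_Ioi] with t ht
            have ht0 : 0 < t := hc0.trans ht
            positivity
      _ ≤ _ := by
          refine ENNReal.ofReal_le_ofReal (le_of_eq ?_)
          rw [integral_const_mul, integral_Ioi_rpow_of_lt (by linarith) hc0, hc,
            Real.mul_rpow hM.le (by positivity), ← Real.rpow_mul hv.le,
            show -1 / p * (-p + 1) = (p - 1) / p by field_simp; ring,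
            show M ^ (-p + 1) = M ^ (-p) * M by
              rw [Real.rpow_add hM, Real.rpow_one], Real.rpow_neg hM.le]
          have h3 : M ^ p ≠ 0 := by positivity
          have h4 : -p + 1 ≠ 0 := by linarith
          have h5 : p - 1 ≠ 0 := hp1.ne'
          have h6 : -p + 1 = -(p - 1) := by ring
          rw [h6]
          field_simp
  rw [← Ioc_union_Ioi_eq_Ioi hc0.le]
  refine (lintegral_union_le _ _ _).trans ((add_le_add h1 h2).trans (le_of_eq ?_))
  rw [ENNReal.ofReal_rpow_of_pos hv, ← ENNReal.ofReal_mul (by positivity),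
    ← ENNReal.ofReal_add (by positivity) (by positivity)]
  congr 1
  field_simp
  ring

/-- Hölder-type bound in weak `L^p`: a function with tail `(M / t)^p`, integrated against a weight
`W ≤ 1`. -/
lemma lintegral_enorm_mul_le_of_tail {μ : Measure ℝ} {M p : ℝ}
    (hM : 0 < M) (hp : 1 < p) {g : ℝ → ℝ} (hg : Measurable g)
    (htail : ∀ t : ℝ, 0 < t → μ {x | t < |g x|} ≤ ENNReal.ofReal (M / t) ^ p)
    {W : ℝ → ℝ≥0∞} (hW : Measurable W) (hW1 : ∀ x, W x ≤ 1) (hWtop : ∫⁻ x, W x ∂μ ≠ ∞) :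
    ∫⁻ x, ‖g x‖ₑ * W x ∂μ
      ≤ ENNReal.ofReal (M * (p / (p - 1))) * (∫⁻ x, W x ∂μ) ^ ((p - 1) / p) := by
  calc ∫⁻ x, ‖g x‖ₑ * W x ∂μ = ∫⁻ x, ENNReal.ofReal |g x| ∂(μ.withDensity W) := by
        rw [lintegral_withDensity_eq_lintegral_mul _ hW (by fun_prop)]
        refine lintegral_congr fun x => ?_
        rw [Pi.mul_apply, mul_comm, Real.enorm_eq_ofReal_abs]
    _ = ∫⁻ t in Ioi 0, μ.withDensity W {x | t < |g x|} :=
        lintegral_eq_lintegral_meas_lt _ (Eventually.of_forall fun x => abs_nonneg _)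
          (by fun_prop)
    _ ≤ ∫⁻ t in Ioi (0 : ℝ), min (∫⁻ x, W x ∂μ) (ENNReal.ofReal (M / t) ^ p) := by
        refine setLIntegral_mono' measurableSet_Ioi fun t ht => ?_
        have hm : MeasurableSet {x | t < |g x|} := measurableSet_lt measurable_const (by fun_prop)
        rw [withDensity_apply _ hm]
        refine le_min (setLIntegral_le_lintegral _ _) (le_trans ?_ (htail t ht))
        calc _ ≤ ∫⁻ x in {x | t < |g x|}, 1 ∂μ := lintegral_mono fun x => hW1 x
          _ = _ := setLIntegral_one _
    _ ≤ _ := lintegral_Ioi_min_rpow_le hM hp hWtop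

lemma integrable_of_tail {μ : Measure ℝ} [IsProbabilityMeasure μ] {M p : ℝ}
    (hM : 0 < M) (hp : 1 < p) {g : ℝ → ℝ} (hg : Measurable g)
    (htail : ∀ t : ℝ, 0 < t → μ {x | t < |g x|} ≤ ENNReal.ofReal (M / t) ^ p) :
    Integrable g μ := by
  refine ⟨hg.aestronglyMeasurable, ?_⟩
  have := lintegral_enorm_mul_le_of_tail hM hp hg htail (W := fun _ => 1) measurable_const
    (fun _ => le_rfl) (by simp)
  simp only [mul_one, lintegral_const, measure_univ, ENNReal.one_rpow] at this
  exact this.trans_lt ENNReal.ofReal_lt_top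

lemma lintegral_enorm_sub_integral_mul_le_of_tail {μ : Measure ℝ} [IsProbabilityMeasure μ]
    {M p : ℝ} (hM : 0 < M) (hp : 1 < p) {g : ℝ → ℝ} (hg : Measurable g)
    (htail : ∀ t : ℝ, 0 < t → μ {x | t < |g x|} ≤ ENNReal.ofReal (M / t) ^ p)
    {W : ℝ → ℝ≥0∞} (hW : Measurable W) (hW1 : ∀ x, W x ≤ 1) :
    ∫⁻ x, ‖g x - ∫ y, g y ∂μ‖ₑ * W x ∂μ
      ≤ 2 * ENNReal.ofReal (M * (p / (p - 1))) * (∫⁻ x, W x ∂μ) ^ ((p - 1) / p) := by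
  have hw1 : ∫⁻ x, W x ∂μ ≤ 1 := by
    calc _ ≤ ∫⁻ x, 1 ∂μ := lintegral_mono fun x => hW1 x
      _ = 1 := by simp
  have hmean : ‖∫ y, g y ∂μ‖ₑ ≤ ENNReal.ofReal (M * (p / (p - 1))) := by
    refine (enorm_integral_le_lintegral_enorm _).trans ?_
    have := lintegral_enorm_mul_le_of_tail hM hp hg htail (W := fun _ => 1) measurable_const
      (fun _ => le_rfl) (by simp)
    simpa using this
  have hpow : ∫⁻ x, W x ∂μ ≤ (∫⁻ x, W x ∂μ) ^ ((p - 1) / p) :=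
    le_of_eq_of_le (ENNReal.rpow_one _).symm
      (ENNReal.rpow_le_rpow_of_exponent_ge hw1 (by rw [div_le_one (by linarith)]; linarith))
  calc ∫⁻ x, ‖g x - ∫ y, g y ∂μ‖ₑ * W x ∂μ
      ≤ ∫⁻ x, (‖g x‖ₑ * W x + ‖∫ y, g y ∂μ‖ₑ * W x) ∂μ := by
        refine lintegral_mono fun x => ?_
        rw [← add_mul]
        gcongr
        exact enorm_sub_le
    _ = ∫⁻ x, ‖g x‖ₑ * W x ∂μ + ‖∫ y, g y ∂μ‖ₑ * ∫⁻ x, W x ∂μ := by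
        rw [lintegral_add_left (by fun_prop), lintegral_const_mul _ hW]
    _ ≤ ENNReal.ofReal (M * (p / (p - 1))) * (∫⁻ x, W x ∂μ) ^ ((p - 1) / p)
        + ENNReal.ofReal (M * (p / (p - 1))) * (∫⁻ x, W x ∂μ) ^ ((p - 1) / p) :=
        add_le_add (lintegral_enorm_mul_le_of_tail hM hp hg htail hW hW1
          (hw1.trans_lt ENNReal.one_lt_top).ne) (mul_le_mul' hmean hpow)
    _ = _ := by ring

lemma enorm_integral_sub_integral_le_lintegral_meas {μ ν : Measure ℝ} [IsProbabilityMeasure μ]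
    [IsProbabilityMeasure ν] {k : ℝ → ℝ} (hk : 0 ≤ k) (hμ : Integrable k μ)
    (hν : Integrable k ν) :
    ‖∫ y, k y ∂ν - ∫ y, k y ∂μ‖ₑ
      ≤ ∫⁻ t in Ioi (0 : ℝ), ‖ν.real {y | t < k y} - μ.real {y | t < k y}‖ₑ := by
  have hint : ∀ ρ : Measure ℝ, IsProbabilityMeasure ρ → Integrable k ρ →
      IntegrableOn (fun t => ρ.real {y | t < k y}) (Ioi 0) := by
    intro ρ _ hρ
    have hanti : Antitone fun t => ρ {y | t < k y} := fun s t hst =>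
      measure_mono fun y (hy : t < k y) => hst.trans_lt hy
    refine integrable_toReal_of_lintegral_ne_top hanti.measurable.aemeasurable ?_
    rw [← lintegral_eq_lintegral_meas_lt ρ (Eventually.of_forall hk) hρ.aemeasurable]
    exact hρ.lintegral_lt_top.ne
  rw [hμ.integral_eq_integral_meas_lt (Eventually.of_forall hk),
    hν.integral_eq_integral_meas_lt (Eventually.of_forall hk),
    ← integral_sub (hint ν inferInstance hν) (hint μ inferInstance hμ)]
  exact enorm_integral_le_lintegral_enorm _

lemma ENNReal.rpow_add_rpow_le_two_mul_min_rpow {x y b T : ℝ≥0∞} {θ : ℝ} (hθ0 : 0 < θ)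
    (hθ1 : θ ≤ 1) (hx : x ≤ b) (hy : y ≤ b) (hxy : x + y ≤ 2 * T) :
    x ^ θ + y ^ θ ≤ 2 * (min b T) ^ θ := by
  rcases le_total b T with h | h
  · rw [min_eq_left h, two_mul]
    gcongr
  · rw [min_eq_right h]
    have key := ENNReal.rpow_arith_mean_le_arith_mean2_rpow (1 / 2) (1 / 2) (x ^ θ) (y ^ θ)
      (ENNReal.add_halves 1) (one_le_one_div hθ0 hθ1)
    rw [← ENNReal.rpow_mul, ← ENNReal.rpow_mul, mul_one_div_cancel hθ0.ne', ENNReal.rpow_one,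
      ENNReal.rpow_one, ← mul_add, ← mul_add] at key
    have h2 : (1 / 2 : ℝ≥0∞) * (x + y) ≤ T := by
      calc (1 / 2 : ℝ≥0∞) * (x + y) ≤ 1 / 2 * (2 * T) := by gcongr
        _ = T := by
          rw [← mul_assoc, one_div, ENNReal.inv_mul_cancel (by simp) (by simp), one_mul]
    have h3 := ENNReal.rpow_le_rpow (key.trans h2) hθ0.le
    rw [← ENNReal.rpow_mul, one_div_mul_cancel hθ0.ne', ENNReal.rpow_one] at h3
    calc x ^ θ + y ^ θ = 2 * (1 / 2 * (x ^ θ + y ^ θ)) := by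
          rw [← mul_assoc, one_div, ENNReal.mul_inv_cancel (by simp) (by simp), one_mul]
      _ ≤ 2 * T ^ θ := by gcongr

lemma measurable_kerDev_superlevel {L : Kernel ℝ ℝ} [IsMarkovKernel L] {μ : Measure ℝ}
    [IsProbabilityMeasure μ] {h : ℝ → ℝ} (hh : Measurable h) :
    Measurable fun q : ℝ × ℝ => kerDev L μ {y | q.2 < h y} q.1 := by
  have hS : MeasurableSet {q : (ℝ × ℝ) × ℝ | q.1.2 < h q.2} :=
    measurableSet_lt (by fun_prop) (by fun_prop)
  have h1 : Measurable fun q : ℝ × ℝ => (L q.1).real {y | q.2 < h y} :=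
    (Kernel.measurable_kernel_prodMk_left (κ := Kernel.prodMkRight ℝ L) hS).ennreal_toReal
  have h2 : Measurable fun q : ℝ × ℝ => μ.real {y | q.2 < h y} :=
    (Kernel.measurable_kernel_prodMk_left (κ := Kernel.const (ℝ × ℝ) μ) hS).ennreal_toReal
  exact (h1.sub h2).enorm

lemma enorm_integral_sub_integral_le_lintegral_kerDev {L : Kernel ℝ ℝ} [IsMarkovKernel L]
    {μ : Measure ℝ} [IsProbabilityMeasure μ] {h : ℝ → ℝ} {x : ℝ} (hμ : Integrable h μ)
    (hL : Integrable h (L x)) :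
    ‖Kop L h x - ∫ y, h y ∂μ‖ₑ
      ≤ ∫⁻ t in Ioi (0 : ℝ), (kerDev L μ {y | t < h y} x + kerDev L μ {y | t < -h y} x) := by
  have hdec : ∀ ρ : Measure ℝ, Integrable h ρ →
      ∫ y, h y ∂ρ = ∫ y, max (h y) 0 ∂ρ - ∫ y, max (-h y) 0 ∂ρ := by
    intro ρ hρ
    rw [← integral_sub hρ.pos_part hρ.neg_part]
    refine integral_congr_ae (Eventually.of_forall fun y => ?_)
    simp
  have hlevel : ∀ k : ℝ → ℝ, ∀ t ∈ Ioi (0 : ℝ), {y | t < max (k y) 0} = {y | t < k y} := by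
    intro k t ht
    ext y
    simp [not_lt.2 (mem_Ioi.1 ht).le]
  have hone : ∀ k : ℝ → ℝ, Integrable (fun y => max (k y) 0) μ →
      Integrable (fun y => max (k y) 0) (L x) →
      ‖∫ y, max (k y) 0 ∂(L x) - ∫ y, max (k y) 0 ∂μ‖ₑ
        ≤ ∫⁻ t in Ioi (0 : ℝ), kerDev L μ {y | t < k y} x := by
    intro k hkμ hkL
    refine (enorm_integral_sub_integral_le_lintegral_meas (fun y => le_max_right _ _) hkμ
      hkL).trans (setLIntegral_mono' measurableSet_Ioi fun t ht => ?_)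
    exact (congrArg (fun J => ‖(L x).real J - μ.real J‖ₑ) (hlevel k t ht)).le
  have hanti : ∀ ρ : Measure ℝ, Measurable fun t => ρ {y | t < h y} := fun ρ =>
    Antitone.measurable fun s t hst => measure_mono fun y (hy : t < h y) => hst.trans_lt hy
  have hmeas : Measurable fun t => kerDev L μ {y | t < h y} x :=
    ((hanti (L x)).ennreal_toReal.sub (hanti μ).ennreal_toReal).enorm
  rw [Kop, hdec μ hμ, hdec (L x) hL, sub_sub_sub_comm, lintegral_add_left hmeas]
  exact enorm_sub_le.trans (add_le_add (hone h hμ.pos_part hL.pos_part)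
    (hone (fun y => -h y) hμ.neg_part hL.neg_part))

/-- The covariance-type inequality for a pair of functions with tail `(M / t)^p`, the second of
which has order-connected level sets. -/
lemma lintegral_enorm_mul_kop_le {L : Kernel ℝ ℝ} [IsMarkovKernel L] {μ : Measure ℝ}
    [IsProbabilityMeasure μ] (hinv : μ.bind L = μ) {A : ℝ≥0∞} (hAtop : A ≠ ∞)
    (hA : ∀ a, ∫⁻ x, kerDev L μ (Iic a) x ∂μ ≤ A) {M p : ℝ} (hM : 0 < M) (hp : 2 < p)
    {g h : ℝ → ℝ} (hg : Measurable g) (hh : Measurable h)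
    (hgtail : ∀ t : ℝ, 0 < t → μ {x | t < |g x|} ≤ ENNReal.ofReal (M / t) ^ p)
    (hhtail : ∀ t : ℝ, 0 < t → μ {x | t < |h x|} ≤ ENNReal.ofReal (M / t) ^ p)
    (hpos : ∀ t : ℝ, 0 < t → {x | t < h x}.OrdConnected)
    (hneg : ∀ t : ℝ, 0 < t → {x | t < -h x}.OrdConnected) :
    ∫⁻ x, ‖g x - ∫ y, g y ∂μ‖ₑ * ‖Kop L h x - ∫ y, h y ∂μ‖ₑ ∂μ
      ≤ ENNReal.ofReal (4 * M ^ 2 * (p / (p - 2))) * (2 * A) ^ ((p - 2) / p) := by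
  have hp0 : 0 < p := by linarith
  have hp1 : 0 < p - 1 := by linarith
  have hp2 : 0 < p - 2 := by linarith
  have hhμ : Integrable h μ := integrable_of_tail hM (by linarith) hh hhtail
  have hhL : ∀ᵐ x ∂μ, Integrable h (L x) :=
    Measure.ae_integrable_of_integrable_comp (by rwa [hinv])
  set θ := (p - 1) / p with hθ
  have hθ0 : 0 < θ := by positivity
  have hθ1 : θ ≤ 1 := by rw [hθ, div_le_one hp0]; linarith
  set C := ENNReal.ofReal (M * (p / (p - 1))) with hC
  set Z : ℝ → ℝ≥0∞ := fun x => ‖g x - ∫ y, g y ∂μ‖ₑ with hZ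
  have hZm : Measurable Z := by fun_prop
  let D : ℝ → ℝ → ℝ≥0∞ := fun x t => kerDev L μ {y | t < h y} x + kerDev L μ {y | t < -h y} x
  have hD : Measurable (Function.uncurry D) :=
    (measurable_kerDev_superlevel hh).add (measurable_kerDev_superlevel hh.neg)
  have hinner : ∀ t ∈ Ioi (0 : ℝ),
      ∫⁻ x, Z x * (kerDev L μ {y | t < h y} x + kerDev L μ {y | t < -h y} x) ∂μ
        ≤ 4 * C * min ((2 * A) ^ θ) (ENNReal.ofReal (M / t) ^ (p - 1)) := by
    intro t ht
    have ht0 : 0 < t := ht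
    have hJ1 := (hpos t ht0).measurableSet
    have hJ2 := (hneg t ht0).measurableSet
    have hdisj : μ {y | t < h y} + μ {y | t < -h y} ≤ ENNReal.ofReal (M / t) ^ p := by
      rw [← measure_union _ hJ2]
      · refine (measure_mono ?_).trans (hhtail t ht0)
        rintro y (hy | hy)
        · exact lt_of_lt_of_le (mem_ofPred.1 hy) (le_abs_self _)
        · exact lt_of_lt_of_le (mem_ofPred.1 hy) (neg_le_abs _)
      · rw [Set.disjoint_left]
        intro y (hy : t < h y) (hy' : t < -h y)
        linarith
    have hone : ∀ J : Set ℝ, MeasurableSet J → ∫⁻ x, Z x * kerDev L μ J x ∂μ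
        ≤ 2 * C * (∫⁻ x, kerDev L μ J x ∂μ) ^ θ := fun J hJ =>
      lintegral_enorm_sub_integral_mul_le_of_tail hM (by linarith) hg hgtail
        (measurable_kerDev hJ) (kerDev_le_one J)
    calc _ = ∫⁻ x, Z x * kerDev L μ {y | t < h y} x ∂μ
          + ∫⁻ x, Z x * kerDev L μ {y | t < -h y} x ∂μ := by
          simp_rw [mul_add]
          exact lintegral_add_left (hZm.mul (measurable_kerDev hJ1)) _
      _ ≤ 2 * C * (∫⁻ x, kerDev L μ {y | t < h y} x ∂μ) ^ θ
          + 2 * C * (∫⁻ x, kerDev L μ {y | t < -h y} x ∂μ) ^ θ :=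
          add_le_add (hone _ hJ1) (hone _ hJ2)
      _ = 2 * C * ((∫⁻ x, kerDev L μ {y | t < h y} x ∂μ) ^ θ
          + (∫⁻ x, kerDev L μ {y | t < -h y} x ∂μ) ^ θ) := by ring
      _ ≤ 2 * C * (2 * (min (2 * A) (ENNReal.ofReal (M / t) ^ p)) ^ θ) := by
          gcongr
          refine ENNReal.rpow_add_rpow_le_two_mul_min_rpow hθ0 hθ1
            (lintegral_kerDev_le_of_ordConnected hA (hpos t ht0))
            (lintegral_kerDev_le_of_ordConnected hA (hneg t ht0)) ?_
          refine (add_le_add (lintegral_kerDev_le_two_mul hinv hJ1)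
            (lintegral_kerDev_le_two_mul hinv hJ2)).trans ?_
          rw [← mul_add]
          gcongr
      _ = _ := by
          rw [(ENNReal.monotone_rpow_of_nonneg hθ0.le).map_min, ← ENNReal.rpow_mul,
            show p * θ = p - 1 by rw [hθ]; field_simp]
          ring
  calc ∫⁻ x, Z x * ‖Kop L h x - ∫ y, h y ∂μ‖ₑ ∂μ
      ≤ ∫⁻ x, (∫⁻ t in Ioi (0 : ℝ),
          Z x * D x t) ∂μ := by
        refine lintegral_mono_ae ?_
        filter_upwards [hhL] with x hx
        rw [lintegral_const_mul]
        · gcongr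
          exact enorm_integral_sub_integral_le_lintegral_kerDev hhμ hx
        · exact hD.of_uncurry_left
    _ = ∫⁻ t in Ioi (0 : ℝ), ∫⁻ x,
          Z x * D x t ∂μ :=
        lintegral_lintegral_swap ((hZm.comp measurable_fst).mul hD).aemeasurable
    _ ≤ ∫⁻ t in Ioi (0 : ℝ), 4 * C * min ((2 * A) ^ θ) (ENNReal.ofReal (M / t) ^ (p - 1)) :=
        setLIntegral_mono' measurableSet_Ioi hinner
    _ = 4 * C * ∫⁻ t in Ioi (0 : ℝ), min ((2 * A) ^ θ) (ENNReal.ofReal (M / t) ^ (p - 1)) :=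
        lintegral_const_mul _ (by fun_prop)
    _ ≤ 4 * C * (ENNReal.ofReal (M * ((p - 1) / (p - 1 - 1)))
          * ((2 * A) ^ θ) ^ ((p - 1 - 1) / (p - 1))) := by
        gcongr
        exact lintegral_Ioi_min_rpow_le hM (by linarith)
          (ENNReal.rpow_ne_top_of_nonneg hθ0.le (ENNReal.mul_ne_top (by simp) hAtop))
    _ = _ := by
        rw [← ENNReal.rpow_mul, hC, show (p - 1 - 1) = p - 2 by ring,
          show θ * ((p - 2) / (p - 1)) = (p - 2) / p by rw [hθ]; field_simp, ← mul_assoc,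
          show (4 : ℝ≥0∞) = ENNReal.ofReal 4 by simp, ← ENNReal.ofReal_mul (by norm_num),
          ← ENNReal.ofReal_mul (by positivity)]
        congr 2
        field_simp

/-- Measurable functions with tail `(M / t)^p` and order-connected level sets. -/
def MonTail (M p : ℝ) (μ : Measure ℝ) (g : ℝ → ℝ) : Prop :=
  Measurable g ∧ (∀ t : ℝ, 0 < t → μ {x | t < |g x|} ≤ ENNReal.ofReal (M / t) ^ p) ∧
    (∀ t : ℝ, 0 < t → {x | t < g x}.OrdConnected) ∧
    (∀ t : ℝ, 0 < t → {x | t < -g x}.OrdConnected)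

lemma MonTail.integrable {M p : ℝ} {μ : Measure ℝ} [IsProbabilityMeasure μ] (hM : 0 < M)
    (hp : 2 < p) {g : ℝ → ℝ} (hg : MonTail M p μ g) : Integrable g μ :=
  integrable_of_tail hM (by linarith) hg.1 hg.2.1

lemma ordConnected_superlevel {h : ℝ → ℝ} {I : Set ℝ} (hI : I.OrdConnected)
    (hmono : MonotoneOn h I ∨ AntitoneOn h I) (hzero : ∀ x ∉ I, h x = 0) {t : ℝ} (ht : 0 ≤ t) :
    {x | t < h x}.OrdConnected := by
  have hmem : ∀ x, t < h x → x ∈ I := fun x hx => by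
    by_contra hxI
    rw [hzero x hxI] at hx
    exact hx.not_ge ht
  refine ⟨fun x (hx : t < h x) y (hy : t < h y) z hz => ?_⟩
  have hzI : z ∈ I := hI.out (hmem x hx) (hmem y hy) hz
  rcases hmono with hm | hm
  · exact hx.trans_le (hm (hmem x hx) hzI hz.1)
  · exact hy.trans_le (hm hzI (hmem y hy) hz.2)

lemma measurable_max_zero_of_ordConnected {h : ℝ → ℝ}
    (hh : ∀ t : ℝ, 0 ≤ t → {x | t < h x}.OrdConnected) : Measurable fun x => max (h x) 0 := by
  refine measurable_of_Ioi fun t => ?_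
  by_cases ht : 0 ≤ t
  · have : (fun x => max (h x) 0) ⁻¹' Ioi t = {x | t < h x} := by
      ext x
      simp [not_lt.2 ht]
    rw [this]
    exact (hh t ht).measurableSet
  · have : (fun x => max (h x) 0) ⁻¹' Ioi t = univ := by
      ext x
      simp [not_le.1 ht]
    rw [this]
    exact MeasurableSet.univ

lemma Mon.monTail {M : ℝ} {p : ℝ≥0∞} {μ : Measure ℝ} [IsProbabilityMeasure μ] (hM : 0 < M)
    {g : ℝ → ℝ} (hg : Mon M p μ g) {r : ℝ} (hr : 0 < r) (hpr : p ≠ ∞ → p.toReal = r) :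
    MonTail M r μ g := by
  obtain ⟨⟨I, -, hI, hmono, hzero⟩, htail⟩ := hg
  have hpos : ∀ t : ℝ, 0 ≤ t → {x | t < g x}.OrdConnected := fun t ht =>
    ordConnected_superlevel hI hmono hzero ht
  have hneg : ∀ t : ℝ, 0 ≤ t → {x | t < -g x}.OrdConnected := fun t ht =>
    ordConnected_superlevel hI (hmono.symm.imp AntitoneOn.neg MonotoneOn.neg)
      (fun x hx => by simp [hzero x hx]) ht
  have hmeas : Measurable g := by
    have h1 := (measurable_max_zero_of_ordConnected hpos).sub
      (measurable_max_zero_of_ordConnected hneg)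
    have h2 : ((fun x => max (g x) 0) - fun x => max (-g x) 0) = g := by
      ext x
      simp
    rwa [h2] at h1
  refine ⟨hmeas, fun t ht => ?_, fun t ht => hpos t ht.le, fun t ht => hneg t ht.le⟩
  by_cases hp : p = ∞
  · rw [if_pos hp] at htail
    rcases le_or_gt M t with hMt | hMt
    · exact (measure_mono_null (fun x (hx : t < |g x|) => hMt.trans_lt hx) htail).le.trans
        zero_le
    · refine prob_le_one.trans ?_
      rw [ENNReal.ofReal_rpow_of_pos (by positivity), ENNReal.one_le_ofReal]
      exact Real.one_le_rpow ((one_le_div ht).2 hMt.le) hr.le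
  · rw [if_neg hp, hpr hp] at htail
    rw [ENNReal.ofReal_rpow_of_pos (by positivity), Real.div_rpow hM.le ht.le, div_eq_mul_inv,
      ← Real.rpow_neg ht.le]
    exact htail t ht

lemma exists_kernel_iterate_kop {K : Kernel ℝ ℝ} [IsMarkovKernel K] {μ : Measure ℝ}
    [IsProbabilityMeasure μ] (hinv : μ.bind K = μ) (n : ℕ) :
    ∃ L : Kernel ℝ ℝ, IsMarkovKernel L ∧ μ.bind L = μ ∧
      ∀ f, Integrable f μ → (Kop K)^[n] f =ᵐ[μ] Kop L f := by
  induction n with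
  | zero =>
    refine ⟨Kernel.id, inferInstance, Measure.id_comp, fun f _ => ?_⟩
    refine Eventually.of_forall fun x => ?_
    simp [Kop, Kernel.id_apply]
  | succ n ih =>
    obtain ⟨L, hLM, hL, hLf⟩ := ih
    have hLK : μ.bind (L ∘ₖ K) = μ := Kernel.Invariant.comp hL hinv
    refine ⟨L ∘ₖ K, inferInstance, hLK, fun f hf => ?_⟩
    have h1 : ∀ᵐ x ∂μ, ∀ᵐ y ∂(K x), (Kop K)^[n] f y = Kop L f y :=
      Measure.ae_ae_of_ae_comp (by rw [hinv]; exact hLf f hf)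
    have h2 : ∀ᵐ x ∂μ, Integrable f ((L ∘ₖ K) x) :=
      Measure.ae_integrable_of_integrable_comp (by rwa [hLK])
    filter_upwards [h1, h2] with x hx1 hx2
    rw [Function.iterate_succ_apply', Kop, integral_congr_ae hx1]
    exact (Kernel.integral_comp hx2).symm

section kop

variable {L : Kernel ℝ ℝ} {μ : Measure ℝ}

lemma measurable_kop {g : ℝ → ℝ} (hg : Measurable g) : Measurable (Kop L g) :=
  (hg.stronglyMeasurable.integral_kernel).measurable

lemma aestronglyMeasurable_kop (hinv : μ.bind L = μ) {f : ℝ → ℝ}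
    (hf : AEStronglyMeasurable f μ) : AEStronglyMeasurable (Kop L f) μ := by
  refine ⟨Kop L (hf.mk f), hf.stronglyMeasurable_mk.integral_kernel, ?_⟩
  have h : ∀ᵐ x ∂μ, ∀ᵐ y ∂(L x), f y = hf.mk f y :=
    Measure.ae_ae_of_ae_comp (by rw [hinv]; exact hf.ae_eq_mk)
  filter_upwards [h] with x hx using integral_congr_ae hx

lemma lintegral_enorm_kop_sub_le (hinv : μ.bind L = μ) {u v : ℝ → ℝ} (hu : Integrable u μ)
    (hv : Integrable v μ) :
    ∫⁻ x, ‖Kop L u x - Kop L v x‖ₑ ∂μ ≤ ∫⁻ x, ‖u x - v x‖ₑ ∂μ := by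
  have hu' : ∀ᵐ x ∂μ, Integrable u (L x) :=
    Measure.ae_integrable_of_integrable_comp (by rwa [hinv])
  have hv' : ∀ᵐ x ∂μ, Integrable v (L x) :=
    Measure.ae_integrable_of_integrable_comp (by rwa [hinv])
  calc ∫⁻ x, ‖Kop L u x - Kop L v x‖ₑ ∂μ ≤ ∫⁻ x, (∫⁻ y, ‖u y - v y‖ₑ ∂(L x)) ∂μ := by
        refine lintegral_mono_ae ?_
        filter_upwards [hu', hv'] with x hx1 hx2
        rw [Kop, Kop, ← integral_sub hx1 hx2]
        exact enorm_integral_le_lintegral_enorm _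
    _ = ∫⁻ y, ‖u y - v y‖ₑ ∂(μ.bind L) := by
        refine (Measure.lintegral_bind L.aemeasurable ?_).symm
        rw [hinv]
        exact (hu.sub hv).aestronglyMeasurable.enorm
    _ = _ := by rw [hinv]

lemma lintegral_enorm_mul_kop_le_of_approx (hinv : μ.bind L = μ) {B : ℝ≥0∞} {f : ℝ → ℝ}
    (hf : Integrable f μ) {F : ℕ → ℝ → ℝ} (hF : ∀ k, Integrable (F k) μ)
    (hlim : Tendsto (fun k => ∫⁻ x, ‖F k x - f x‖ₑ ∂μ) atTop (𝓝 0))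
    (hB : ∀ k, ∫⁻ x, ‖F k x - ∫ y, F k y ∂μ‖ₑ * ‖Kop L (F k) x - ∫ y, F k y ∂μ‖ₑ ∂μ ≤ B) :
    ∫⁻ x, ‖f x - ∫ y, f y ∂μ‖ₑ * ‖Kop L f x - ∫ y, f y ∂μ‖ₑ ∂μ ≤ B := by
  have hlimK : Tendsto (fun k => ∫⁻ x, ‖Kop L (F k) x - Kop L f x‖ₑ ∂μ) atTop (𝓝 0) :=
    tendsto_of_tendsto_of_tendsto_of_le_of_le tendsto_const_nhds hlim (fun _ => zero_le)
      fun k => lintegral_enorm_kop_sub_le hinv (hF k) hf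
  have hmean := tendsto_integral_of_L1 f hf.aestronglyMeasurable (Eventually.of_forall hF) hlim
  have hKm : ∀ k, AEStronglyMeasurable (Kop L (F k)) μ := fun k =>
    aestronglyMeasurable_kop hinv (hF k).aestronglyMeasurable
  obtain ⟨ns, hns, hae⟩ := (tendstoInMeasure_of_tendsto_eLpNorm one_ne_zero
    (fun k => (hF k).aestronglyMeasurable) hf.aestronglyMeasurable
    (by simpa [eLpNorm_one_eq_lintegral_enorm] using hlim)).exists_seq_tendsto_ae
  obtain ⟨ms, hms, hae'⟩ := (tendstoInMeasure_of_tendsto_eLpNorm one_ne_zero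
    (fun k => hKm (ns k)) (aestronglyMeasurable_kop hinv hf.aestronglyMeasurable)
    (by simpa [eLpNorm_one_eq_lintegral_enorm, Function.comp_def] using
      hlimK.comp hns.tendsto_atTop)).exists_seq_tendsto_ae
  have hmean' := hmean.comp (hns.comp hms).tendsto_atTop
  let G : ℕ → ℝ → ℝ≥0∞ := fun k x =>
    ‖(F k x - ∫ y, F k y ∂μ) * (Kop L (F k) x - ∫ y, F k y ∂μ)‖ₑ
  calc ∫⁻ x, ‖f x - ∫ y, f y ∂μ‖ₑ * ‖Kop L f x - ∫ y, f y ∂μ‖ₑ ∂μ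
      = ∫⁻ x, liminf (fun k => G (ns (ms k)) x) atTop ∂μ := by
        refine lintegral_congr_ae ?_
        filter_upwards [hae, hae'] with x hx hx'
        rw [← enorm_mul]
        exact (((hx.comp hms.tendsto_atTop).sub hmean').mul (hx'.sub hmean')).enorm.liminf_eq.symm
    _ ≤ liminf (fun k => ∫⁻ x, G (ns (ms k)) x ∂μ) atTop :=
        lintegral_liminf_le' fun k => (((hF _).aestronglyMeasurable.sub
          aestronglyMeasurable_const).mul ((hKm _).sub aestronglyMeasurable_const)).enorm
    _ ≤ B := by
        refine (liminf_le_liminf (v := fun _ => B) (Eventually.of_forall fun k => ?_)).trans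
          (by simp)
        simpa only [G, enorm_mul] using hB (ns (ms k))

variable [IsMarkovKernel L] [IsProbabilityMeasure μ]

lemma lintegral_enorm_mul_kop_sum_le (hinv : μ.bind L = μ) {A : ℝ≥0∞} (hAtop : A ≠ ∞)
    (hA : ∀ a, ∫⁻ x, kerDev L μ (Iic a) x ∂μ ≤ A) {M p : ℝ} (hM : 0 < M) (hp : 2 < p)
    {n : ℕ} {a : Fin n → ℝ} {g : Fin n → ℝ → ℝ} (ha : ∑ i, |a i| ≤ 1)
    (hg : ∀ i, MonTail M p μ (g i)) :
    ∫⁻ x, ‖∑ i, a i * g i x - ∫ y, ∑ i, a i * g i y ∂μ‖ₑ *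
        ‖Kop L (fun y => ∑ i, a i * g i y) x - ∫ y, ∑ i, a i * g i y ∂μ‖ₑ ∂μ
      ≤ ENNReal.ofReal (4 * M ^ 2 * (p / (p - 2))) * (2 * A) ^ ((p - 2) / p) := by
  set B := ENNReal.ofReal (4 * M ^ 2 * (p / (p - 2))) * (2 * A) ^ ((p - 2) / p)
  have hint : ∀ i, Integrable (g i) μ := fun i => (hg i).integrable hM hp
  have hintL : ∀ᵐ x ∂μ, ∀ i, Integrable (g i) (L x) := ae_all_iff.2 fun i =>
    Measure.ae_integrable_of_integrable_comp (by rw [hinv]; exact hint i)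
  have hsum : ∀ ρ : Measure ℝ, (∀ i, Integrable (g i) ρ) →
      ∫ y, ∑ i, a i * g i y ∂ρ = ∑ i, a i * ∫ y, g i y ∂ρ := fun ρ hρ => by
    rw [integral_finsetSum _ fun i _ => (hρ i).const_mul _]
    simp_rw [integral_const_mul]
  have ha1 : ∑ i, ‖a i‖ₑ ≤ 1 := by
    simp_rw [Real.enorm_eq_ofReal_abs]
    rw [← ENNReal.ofReal_sum_of_nonneg fun i _ => abs_nonneg _]
    exact ENNReal.ofReal_le_one.2 ha
  have hZm : ∀ i, Measurable fun x => ‖g i x - ∫ y, g i y ∂μ‖ₑ := fun i =>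
    ((hg i).1.sub_const _).enorm
  have hYm : ∀ i, Measurable fun x => ‖Kop L (g i) x - ∫ y, g i y ∂μ‖ₑ := fun i =>
    ((measurable_kop (hg i).1).sub_const _).enorm
  have hbound : ∀ u : Fin n → ℝ, ‖∑ i, a i * u i‖ₑ ≤ ∑ i, ‖a i‖ₑ * ‖u i‖ₑ := fun u =>
    (enorm_sum_le _ _).trans (le_of_eq (by simp_rw [enorm_mul]))
  calc _ ≤ ∫⁻ x, ∑ i, ∑ j, (‖a i‖ₑ * ‖a j‖ₑ) * (‖g i x - ∫ y, g i y ∂μ‖ₑ *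
          ‖Kop L (g j) x - ∫ y, g j y ∂μ‖ₑ) ∂μ := by
        refine lintegral_mono_ae ?_
        filter_upwards [hintL] with x hx
        rw [Kop, hsum μ hint, hsum (L x) hx, ← Finset.sum_sub_distrib, ← Finset.sum_sub_distrib]
        simp_rw [← mul_sub]
        refine (mul_le_mul' (hbound _) (hbound _)).trans (le_of_eq ?_)
        rw [Finset.sum_mul_sum]
        refine Finset.sum_congr rfl fun i _ => Finset.sum_congr rfl fun j _ => ?_
        rw [Kop]
        ring
    _ = ∑ i, ∑ j, (‖a i‖ₑ * ‖a j‖ₑ) * ∫⁻ x, ‖g i x - ∫ y, g i y ∂μ‖ₑ *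
          ‖Kop L (g j) x - ∫ y, g j y ∂μ‖ₑ ∂μ := by
        have hm : ∀ i j, Measurable fun x => ‖g i x - ∫ y, g i y ∂μ‖ₑ *
            ‖Kop L (g j) x - ∫ y, g j y ∂μ‖ₑ := fun i j => (hZm i).mul (hYm j)
        rw [lintegral_finsetSum _ fun i _ => Finset.measurable_fun_sum _ fun j _ =>
          (hm i j).const_mul _]
        refine Finset.sum_congr rfl fun i _ => ?_
        rw [lintegral_finsetSum _ fun j _ => (hm i j).const_mul _]
        exact Finset.sum_congr rfl fun j _ => lintegral_const_mul _ (hm i j)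
    _ ≤ ∑ i, ∑ j, (‖a i‖ₑ * ‖a j‖ₑ) * B := by
        gcongr with i _ j _
        exact lintegral_enorm_mul_kop_le hinv hAtop hA hM hp (hg i).1 (hg j).1 (hg i).2.1
          (hg j).2.1 (hg j).2.2.1 (hg j).2.2.2
    _ = (∑ i, ‖a i‖ₑ) * (∑ j, ‖a j‖ₑ) * B := by
        rw [Finset.sum_mul_sum, Finset.sum_mul]
        simp_rw [Finset.sum_mul]
    _ ≤ 1 * 1 * B := by gcongr
    _ = B := by simp

lemma lintegral_enorm_mul_kop_le_of_classC (hinv : μ.bind L = μ) {A : ℝ≥0∞} (hAtop : A ≠ ∞)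
    (hA : ∀ a, ∫⁻ x, kerDev L μ (Iic a) x ∂μ ≤ A) {M r : ℝ} (hM : 0 < M) (hr : 2 < r)
    {p : ℝ≥0∞} (hpr : p ≠ ∞ → p.toReal = r) {f : ℝ → ℝ} (hf : ClassC M p μ f) :
    ∫⁻ x, ‖f x - ∫ y, f y ∂μ‖ₑ * ‖Kop L f x - ∫ y, f y ∂μ‖ₑ ∂μ
      ≤ ENNReal.ofReal (4 * M ^ 2 * (r / (r - 2))) * (2 * A) ^ ((r - 2) / r) := by
  obtain ⟨hfint, happrox⟩ := hf
  choose n a g ha hg hclose using fun k : ℕ => happrox (1 / ((k : ℝ) + 1)) (by positivity)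
  have hg' : ∀ k i, MonTail M r μ (g k i) := fun k i => (hg k i).monTail hM (by linarith) hpr
  have hF : ∀ k, Integrable (fun x => ∑ i, a k i * g k i x) μ := fun k =>
    integrable_finsetSum _ fun i _ => ((hg' k i).integrable hM hr).const_mul _
  refine lintegral_enorm_mul_kop_le_of_approx hinv hfint hF ?_ fun k =>
    lintegral_enorm_mul_kop_sum_le hinv hAtop hA hM hr (ha k) (hg' k)
  refine tendsto_of_tendsto_of_tendsto_of_le_of_le tendsto_const_nhds
    (h := fun k : ℕ => ENNReal.ofReal (1 / ((k : ℝ) + 1))) ?_ (fun _ => zero_le) fun k => ?_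
  · simpa using ENNReal.tendsto_ofReal (tendsto_one_div_add_atTop_nhds_zero_nat (𝕜 := ℝ))
  · calc ∫⁻ x, ‖∑ i, a k i * g k i x - f x‖ₑ ∂μ
        = ENNReal.ofReal (∫ x, ‖f x - ∑ i, a k i * g k i x‖ ∂μ) := by
          refine Eq.trans ?_ (ofReal_integral_norm_eq_lintegral_enorm (hfint.sub (hF k))).symm
          exact lintegral_congr fun x => enorm_sub_rev _ _
      _ ≤ _ := ENNReal.ofReal_le_ofReal (hclose k).le

end kop

lemma integral_indic (ρ : Measure ℝ) (t : ℝ) : ∫ y, indic t y ∂ρ = ρ.real (Iic t) := by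
  simp [indic, integral_indicator measurableSet_Iic]

lemma alpha1_nonneg (T : (ℝ → ℝ) → ℝ → ℝ) (μ : Measure ℝ) (n : ℕ) : 0 ≤ alpha1 T μ n :=
  Real.iSup_nonneg fun _ => integral_nonneg fun _ => abs_nonneg _

lemma lintegral_kerDev_Iic_le_alpha1 {K L : Kernel ℝ ℝ} [IsMarkovKernel L] {μ : Measure ℝ}
    [IsProbabilityMeasure μ] {n : ℕ}
    (hL : ∀ f, Integrable f μ → (Kop K)^[n] f =ᵐ[μ] Kop L f) (a : ℝ) :
    ∫⁻ x, kerDev L μ (Iic a) x ∂μ ≤ ENNReal.ofReal (alpha1 (Kop K) μ n) := by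
  have hnorm : ∀ t : ℝ, ∀ᵐ x ∂μ,
      ‖|(Kop K)^[n] (indic t) x - ∫ y, indic t y ∂μ|‖ₑ = kerDev L μ (Iic t) x := fun t => by
    filter_upwards [hL (indic t) ((integrable_const 1).indicator measurableSet_Iic)] with x hx
    rw [hx, Kop, integral_indic, integral_indic, kerDev, ← Real.norm_eq_abs, enorm_norm]
  have hval : ∀ t : ℝ, ENNReal.ofReal (∫ x, |(Kop K)^[n] (indic t) x - ∫ y, indic t y ∂μ| ∂μ)
      = ∫⁻ x, kerDev L μ (Iic t) x ∂μ := fun t => by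
    have hae : (fun x => |(Kop K)^[n] (indic t) x - ∫ y, indic t y ∂μ|) =ᵐ[μ]
        fun x => (kerDev L μ (Iic t) x).toReal := by
      filter_upwards [hnorm t] with x hx
      rw [← hx, toReal_enorm, norm_abs_eq_norm, Real.norm_eq_abs]
    rw [integral_congr_ae hae, integral_toReal (measurable_kerDev measurableSet_Iic).aemeasurable
      (Eventually.of_forall fun x => (kerDev_le_one _ x).trans_lt ENNReal.one_lt_top),
      ENNReal.ofReal_toReal]
    refine ne_top_of_le_ne_top ENNReal.one_ne_top
      ((lintegral_mono fun x => kerDev_le_one (Iic t) x).trans (by simp))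
  rw [← hval]
  refine ENNReal.ofReal_le_ofReal (le_ciSup (f := fun t : ℝ =>
    ∫ x, |(Kop K)^[n] (indic t) x - ∫ y, indic t y ∂μ| ∂μ) ⟨1, ?_⟩ a)
  rintro _ ⟨t, rfl⟩
  rw [← ENNReal.ofReal_le_one, hval]
  exact (lintegral_mono fun x => kerDev_le_one (Iic t) x).trans (by simp)

lemma ofReal_integral_mul_iterate_kop_le {μ : Measure ℝ} [IsProbabilityMeasure μ]
    {K : Kernel ℝ ℝ} [IsMarkovKernel K] (hinv : μ.bind K = μ) {M r : ℝ} (hM : 0 < M)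
    (hr : 2 < r) {p : ℝ≥0∞} (hpr : p ≠ ∞ → p.toReal = r) {f : ℝ → ℝ} (hf : ClassC M p μ f)
    (n : ℕ) :
    ENNReal.ofReal (∫ x, |(f x - ∫ y, f y ∂μ) * ((Kop K)^[n] f x - ∫ y, f y ∂μ)| ∂μ)
      ≤ ENNReal.ofReal (4 * M ^ 2 * (r / (r - 2))) *
        ENNReal.ofReal ((2 * alpha1 (Kop K) μ n) ^ ((r - 2) / r)) := by
  obtain ⟨L, hLM, hL, hLf⟩ := exists_kernel_iterate_kop hinv n
  have hα := alpha1_nonneg (Kop K) μ n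
  calc ENNReal.ofReal (∫ x, |(f x - ∫ y, f y ∂μ) * ((Kop K)^[n] f x - ∫ y, f y ∂μ)| ∂μ)
      ≤ ∫⁻ x, ‖|(f x - ∫ y, f y ∂μ) * ((Kop K)^[n] f x - ∫ y, f y ∂μ)|‖ₑ ∂μ :=
        (Real.ofReal_le_enorm _).trans (enorm_integral_le_lintegral_enorm _)
    _ = ∫⁻ x, ‖f x - ∫ y, f y ∂μ‖ₑ * ‖Kop L f x - ∫ y, f y ∂μ‖ₑ ∂μ := by
        refine lintegral_congr_ae ?_
        filter_upwards [hLf f hf.1] with x hx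
        rw [hx, ← Real.norm_eq_abs, enorm_norm, enorm_mul]
    _ ≤ ENNReal.ofReal (4 * M ^ 2 * (r / (r - 2))) *
          (2 * ENNReal.ofReal (alpha1 (Kop K) μ n)) ^ ((r - 2) / r) :=
        lintegral_enorm_mul_kop_le_of_classC hL ENNReal.ofReal_ne_top
          (lintegral_kerDev_Iic_le_alpha1 hLf) hM hr hpr hf
    _ = _ := by
        rw [← ENNReal.ofReal_rpow_of_nonneg (by positivity)
          (div_nonneg (by linarith) (by linarith)), ENNReal.ofReal_mul zero_le_two,
          ENNReal.ofReal_ofNat]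

lemma toReal_one_sub_two_div {p : ℝ≥0∞} (hp : 2 < p) (hp' : p ≠ ∞) :
    ((1 : ℝ≥0∞) - 2 / p).toReal = (p.toReal - 2) / p.toReal := by
  have hpos : 0 < p.toReal := ENNReal.toReal_pos (by positivity) hp'
  rw [ENNReal.toReal_sub_of_le (ENNReal.div_le_of_le_mul (by simpa using hp.le))
    ENNReal.one_ne_top, ENNReal.toReal_div, sub_div, div_self hpos.ne']
  simp

lemma ofReal_integral_mul_iterate_kop_le_of_two_lt {μ : Measure ℝ} [IsProbabilityMeasure μ]
    {K : Kernel ℝ ℝ} [IsMarkovKernel K] (hinv : μ.bind K = μ) {M : ℝ} (hM : 0 < M)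
    {p : ℝ≥0∞} (hp : 2 < p) {f : ℝ → ℝ} (hf : ClassC M p μ f) (n : ℕ) :
    ENNReal.ofReal (∫ x, |(f x - ∫ y, f y ∂μ) * ((Kop K)^[n] f x - ∫ y, f y ∂μ)| ∂μ)
      ≤ ENNReal.ofReal (4 * M ^ 2 * (((1 : ℝ≥0∞) - 2 / p)⁻¹).toReal) *
        ENNReal.ofReal ((2 * alpha1 (Kop K) μ n) ^ (((1 : ℝ≥0∞) - 2 / p).toReal)) := by
  by_cases hp' : p = ∞
  · have hinvLim : Tendsto (fun r : ℝ => 2 / r) atTop (𝓝 0) :=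
      tendsto_const_nhds.div_atTop tendsto_id
    have hexp : Tendsto (fun r : ℝ => (r - 2) / r) atTop (𝓝 1) := by
      refine Tendsto.congr' (f₁ := fun r : ℝ => 1 - 2 / r) ?_ (by simpa using hinvLim.const_sub 1)
      filter_upwards [eventually_gt_atTop 0] with r hr
      rw [sub_div, div_self hr.ne']
    have hcoef : Tendsto (fun r : ℝ => r / (r - 2)) atTop (𝓝 1) := by
      simpa using hexp.inv₀ one_ne_zero
    have hpow : Tendsto (fun r : ℝ => (2 * alpha1 (Kop K) μ n) ^ ((r - 2) / r)) atTop
        (𝓝 ((2 * alpha1 (Kop K) μ n) ^ (1 : ℝ))) :=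
      (Real.continuousAt_const_rpow' one_ne_zero).tendsto.comp hexp
    have hlim : Tendsto (fun r : ℝ => ENNReal.ofReal (4 * M ^ 2 * (r / (r - 2))) *
        ENNReal.ofReal ((2 * alpha1 (Kop K) μ n) ^ ((r - 2) / r))) atTop
        (𝓝 (ENNReal.ofReal (4 * M ^ 2 * 1) *
          ENNReal.ofReal ((2 * alpha1 (Kop K) μ n) ^ (1 : ℝ)))) :=
      ENNReal.Tendsto.mul (ENNReal.tendsto_ofReal (hcoef.const_mul _))
        (Or.inr ENNReal.ofReal_ne_top) (ENNReal.tendsto_ofReal hpow)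
        (Or.inr ENNReal.ofReal_ne_top)
    have hsub : (1 : ℝ≥0∞) - 2 / p = 1 := by simp [hp']
    rw [hsub, inv_one, ENNReal.toReal_one]
    refine ge_of_tendsto hlim ?_
    filter_upwards [eventually_gt_atTop 2] with r hr
    exact ofReal_integral_mul_iterate_kop_le hinv hM hr (fun h => (h hp').elim) hf n
  · have hr : 2 < p.toReal := by
      simpa using (ENNReal.toReal_lt_toReal ENNReal.ofNat_ne_top hp').2 hp
    rw [ENNReal.toReal_inv, toReal_one_sub_two_div hp hp', inv_div]
    exact ofReal_integral_mul_iterate_kop_le hinv hM hr (fun _ => rfl) hf n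

/-- inequality (1) of Dedecker–Prieur: for `p ∈ (2,∞]` and
`f ∈ C(M,p,μ)`,
`Σ_{n>0} ‖(f(X_0)−μ(f))(E(f(X_n)|X_0)−μ(f))‖₁
  ≤ (4pM²/(p−2)) Σ_{n>0} (2α_1(n))^{(p−2)/p}`,
stated as an inequality in `[0,∞]` (both sides may be infinite).  Here
`E(f(X_n)|X_0) = (K^n f)(X_0)`, `X_0 ∼ μ`; for `p = ∞`, `(p−2)/p = 1` and
`4pM²/(p−2) = 4M²`, which is how `1 − 2/p` and `(1 − 2/p)⁻¹` behave in `ℝ≥0∞`. -/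
theorem statement4 (μ : Measure ℝ) [IsProbabilityMeasure μ]
    (K : Kernel ℝ ℝ) [IsMarkovKernel K] (hinv : μ.bind (fun x => K x) = μ)
    (M : ℝ) (hM : 0 < M) (p : ℝ≥0∞) (hp : 2 < p)
    (f : ℝ → ℝ) (hf : ClassC M p μ f) :
    ∑' n : ℕ, ENNReal.ofReal
        (∫ x, |(f x - ∫ y, f y ∂μ) * ((Kop K)^[n + 1] f x - ∫ y, f y ∂μ)| ∂μ)
      ≤ ENNReal.ofReal (4 * M ^ 2 * (((1:ℝ≥0∞) - 2 / p)⁻¹).toReal) *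
          ∑' n : ℕ, ENNReal.ofReal
            ((2 * alpha1 (Kop K) μ (n + 1)) ^ (((1:ℝ≥0∞) - 2 / p).toReal)) := by
  rw [← ENNReal.tsum_mul_left]
  exact ENNReal.tsum_le_tsum fun n =>
    ofReal_integral_mul_iterate_kop_le_of_two_lt hinv hM hp hf (n + 1)

end
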